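/- Let V be a finite-dimensional vector space over a field and N : V → V nilpotent. Define M_k = Σ_{j ≥ max(0,−k)} (ker(N^{k+j+1}) ∩ range(N^j)). Then M is the monodromy filtration of N: it is increasing, exhaustive, separated, N(M_k) ⊆ M_{k-2}, and N^k induces an isomorphism M_k/M_{k-1} ≅ M_{-k}/M_{-k-1} for all k ≥ 0. -/

import Mathlib

open Module

/-- `M` is a monodromy filtration for the nilpotent operator `N`: it is an increasing
filtration, separated (`M k = ⊥` for `k ≪ 0`), exhaustive (`M k = ⊤` for `k ≫ 0`),
satisfies `N (M k) ⊆ M (k - 2)`, and for every `k ≥ 0` the map induced by `N ^ k`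
from `Gr^M_k = M k / M (k-1)` to `Gr^M_{-k} = M (-k) / M (-k-1)` is injective and
surjective (i.e. an isomorphism). -/
def IsMonodromyFiltration {K V : Type*} [Field K] [AddCommGroup V] [Module K V]
    (N : V →ₗ[K] V) (M : ℤ → Submodule K V) : Prop :=
  Monotone M ∧
  (∃ a : ℤ, ∀ k ≤ a, M k = ⊥) ∧
  (∃ b : ℤ, ∀ k, b ≤ k → M k = ⊤) ∧
  (∀ k : ℤ, ∀ x ∈ M k, N x ∈ M (k - 2)) ∧
  (∀ k : ℕ,
    (∀ x ∈ M (k : ℤ), (N ^ k) x ∈ M (-(k : ℤ) - 1) → x ∈ M ((k : ℤ) - 1)) ∧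
    (∀ y ∈ M (-(k : ℤ)), ∃ x ∈ M (k : ℤ), (N ^ k) x - y ∈ M (-(k : ℤ) - 1)))

/-- The explicit filtration. -/
def monoFil {K V : Type*} [Field K] [AddCommGroup V] [Module K V]
    (N : V →ₗ[K] V) (k : ℤ) : Submodule K V :=
  ⨆ j ∈ {j : ℕ | 0 ≤ k + (j : ℤ)},
    LinearMap.ker (N ^ (k + (j : ℤ) + 1).toNat) ⊓ LinearMap.range (N ^ j)

section
variable {K V : Type*} [Field K] [AddCommGroup V] [Module K V] (N : V →ₗ[K] V)

lemma monoFil_mem (k : ℤ) (a b : ℕ) (h : (a : ℤ) = k + b + 1) (z : V)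
    (hz : (N ^ a) ((N ^ b) z) = 0) : (N ^ b) z ∈ monoFil N k := by
  rcases Nat.eq_zero_or_pos a with rfl | ha
  · have : (N ^ b) z = 0 := by simpa using hz
    rw [this]; exact Submodule.zero_mem _
  · have hj : b ∈ {j : ℕ | 0 ≤ k + (j : ℤ)} := by
      simp only [Set.mem_setOf_eq]; omega
    refine Submodule.mem_iSup_of_mem b (Submodule.mem_iSup_of_mem hj ⟨?_, ⟨z, rfl⟩⟩)
    have : (k + (b : ℤ) + 1).toNat = a := by omega
    rw [this]; exact hz

lemma monoFil_le (k : ℤ) (S : Submodule K V)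
    (h : ∀ (a b : ℕ), 1 ≤ a → (a : ℤ) = k + b + 1 → ∀ z, (N ^ a) ((N ^ b) z) = 0 →
      (N ^ b) z ∈ S) : monoFil N k ≤ S := by
  refine iSup₂_le fun j hj => ?_
  simp only [Set.mem_setOf_eq] at hj
  rintro x ⟨h1, ⟨z, rfl⟩⟩
  exact h (k + (j : ℤ) + 1).toNat j (by omega) (by omega) z h1

lemma monoFil_N (k : ℤ) : monoFil N k ≤ (monoFil N (k - 2)).comap N := by
  refine monoFil_le N k _ fun a b ha hab z hz => ?_
  obtain ⟨a, rfl⟩ : ∃ c, a = c + 1 := ⟨a - 1, by omega⟩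
  have e : N ((N ^ b) z) = (N ^ (b + 1)) z := by rw [pow_succ']; rfl
  rw [Submodule.mem_comap, e]
  refine monoFil_mem N _ a (b + 1) (by push_cast at *; omega) z ?_
  rw [← e]
  rw [pow_succ] at hz
  exact hz

lemma monoFil_surj (k : ℕ) :
    monoFil N (-(k : ℤ)) ≤ (monoFil N (k : ℤ)).map (N ^ k) := by
  refine monoFil_le N _ _ fun a b ha hab z hz => ?_
  obtain ⟨c, rfl⟩ : ∃ c, b = k + c := ⟨b - k, by omega⟩
  refine ⟨(N ^ c) z, monoFil_mem N _ (a + k) c (by push_cast at *; omega) z ?_, ?_⟩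
  · simpa [pow_add] using hz
  · simp [pow_add]

end

/-- The explicit formula `M k = Σ_{j ≥ max(0,-k)} (ker N^(k+j+1) ∩ range N^j)`
gives the monodromy filtration of a nilpotent endomorphism. -/
theorem monodromy_filtration_explicit {K V : Type*} [Field K] [AddCommGroup V] [Module K V]
    [FiniteDimensional K V] (N : V →ₗ[K] V) (hN : IsNilpotent N) :
    IsMonodromyFiltration N (fun k : ℤ =>
      ⨆ j ∈ {j : ℕ | 0 ≤ k + (j : ℤ)},
        LinearMap.ker (N ^ (k + (j : ℤ) + 1).toNat) ⊓ LinearMap.range (N ^ j)) := by 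
  change IsMonodromyFiltration N (monoFil N)
  obtain ⟨n, hn⟩ := hN
  have hn' : ∀ m, n ≤ m → N ^ m = 0 := fun m hm => pow_eq_zero_of_le hm hn
  refine ⟨?_, ⟨-n, ?_⟩, ⟨n, ?_⟩, fun k x hx => monoFil_N N k hx, fun k => ⟨?_, ?_⟩⟩
  · refine monotone_int_of_le_succ fun k => monoFil_le N _ _ fun a b ha hab z hz => ?_
    refine monoFil_mem N _ (a + 1) b (by push_cast; omega) z ?_
    rw [pow_succ', Module.End.mul_apply, hz, map_zero]
  · intro k hk
    refine le_bot_iff.mp (monoFil_le N _ _ fun a b ha hab z hz => ?_)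
    rw [hn' b (by omega)]; simp
  · intro k hk
    refine top_le_iff.mp fun z _ => ?_
    have := monoFil_mem N k (k + 1).toNat 0 (by push_cast; omega) z
      (by rw [hn' _ (by omega)]; simp)
    simpa using this
  · intro x _ hx
    have e : (-(k : ℤ) - 1) = -((k + 1 : ℕ) : ℤ) := by push_cast; ring
    rw [e] at hx
    obtain ⟨w, hw, hwx⟩ := monoFil_surj N (k + 1) hx
    have h1 := monoFil_N N _ hw
    have e2 : (((k + 1 : ℕ) : ℤ) - 2) = (k : ℤ) - 1 := by push_cast; ring
    rw [Submodule.mem_comap, e2] at h1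
    have h2 : x - N w ∈ monoFil N ((k : ℤ) - 1) := by
      have := monoFil_mem N ((k : ℤ) - 1) k 0 (by push_cast; ring) (x - N w) (by
        rw [pow_succ, Module.End.mul_apply] at hwx
        simp [hwx])
      simpa using this
    simpa using Submodule.add_mem _ h2 h1
  · intro y hy
    obtain ⟨x, hx, hxy⟩ := monoFil_surj N k hy
    exact ⟨x, hx, by rw [hxy, sub_self]; exact Submodule.zero_mem _⟩
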